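/- Let k ≥ 2 be an integer and let V_0 : A_k^ℕ → ℝ be defined by V_0(x) = 1/δ_{s_k}(x) when δ_{s_k}(x) < ∞ and V_0(x) = 0 when x ∈ Σ_{s_k}. Then for every x ∈ A_k^ℕ, the sequence (R^n V_0)(x) converges as n → ∞ to U(x), where U(x) = log(1 + v_{x_0}/(λ/(λ−1) + Σ_{l∈A_k} v_l·|x_{[0…δ_{s_k}(x)−1]}|_l − v_{x_0})) when δ_{s_k}(x) < ∞ and U(x) = 0 when x ∈ Σ_{s_k}. -/

import Mathlib

/-- The `k`-bonacci substitution on letters: `a ↦ 0(a+1)` if `a ≠ k-1`, and `k-1 ↦ 0`. -/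
def sLetter {k : ℕ} (a : Fin k) : List (Fin k) :=
  if h : (a : ℕ) + 1 < k then
    [⟨0, Nat.lt_of_le_of_lt (Nat.zero_le _) a.isLt⟩, ⟨(a : ℕ) + 1, h⟩]
  else
    [⟨0, Nat.lt_of_le_of_lt (Nat.zero_le _) a.isLt⟩]

/-- Extension of the substitution to finite words by concatenation. -/
def sWord {k : ℕ} (w : List (Fin k)) : List (Fin k) := w.flatMap sLetter

/-- The prefix of length `n` of a right-infinite sequence. -/
def pref {k : ℕ} (x : ℕ → Fin k) (n : ℕ) : List (Fin k) :=
  (List.range n).map x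

/-- Extension of the substitution to right-infinite sequences, by concatenating the
images of the letters: since each letter has a nonempty image, the `m`-th letter of the
image is the `m`-th letter of the image of the prefix of length `m+1`. -/
def sSeq {k : ℕ} (x : ℕ → Fin k) : ℕ → Fin k :=
  fun m => (sWord (pref x (m + 1))).getD m (x 0)

/-- The left shift on sequences. -/
def shift {k : ℕ} (x : ℕ → Fin k) : ℕ → Fin k := fun n => x (n + 1)

/-- The language of the substitution: finite words occurring as a subword of some `s^m(a)`. -/
def Lang {k : ℕ} (w : List (Fin k)) : Prop :=
  ∃ (a : Fin k) (m : ℕ), w <:+: sWord^[m] [a]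

/-- `delta x = sup {n : prefix of x of length n is in the language}`, valued in `ℕ∞`. -/
noncomputable def delta {k : ℕ} (x : ℕ → Fin k) : ℕ∞ :=
  sSup {N : ℕ∞ | ∃ n : ℕ, N = (n : ℕ∞) ∧ Lang (pref x n)}

/-- The subshift associated to the substitution: sequences all of whose subwords
lie in the language. -/
def Attr (k : ℕ) : Set (ℕ → Fin k) :=
  {x | ∀ i n, Lang ((List.range n).map (fun j => x (i + j)))}

/-- The renormalization operator. -/
noncomputable def Renorm {k : ℕ} (V : (ℕ → Fin k) → ℝ) : (ℕ → Fin k) → ℝ :=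
  fun x => ∑ j ∈ Finset.range (sLetter (x 0)).length, V (shift^[j] (sSeq x))

/-- `vcoef k lam l = lam^{-(k-1-l)} * ∑_{j=0}^{k-1-l} lam^j`. -/
noncomputable def vcoef (k : ℕ) (lam : ℝ) (l : ℕ) : ℝ :=
  (∑ j ∈ Finset.range (k - l), lam ^ j) / lam ^ (k - 1 - l)

/-- The fixed point of the renormalization operator. -/
noncomputable def Ufix (k : ℕ) (lam : ℝ) (x : ℕ → Fin k) : ℝ :=
  if delta x = ⊤ then 0
  else Real.log (1 + vcoef k lam (x 0) /
    (lam / (lam - 1)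
      + (∑ l : Fin k, vcoef k lam (l : ℕ) * ((pref x (delta x).toNat).count l : ℝ))
      - vcoef k lam (x 0)))

/-- The word `s^n(0) · s^{n-1}(0) ⋯ s(0) · 0`. -/
def bword {k : ℕ} (z : Fin k) (n : ℕ) : List (Fin k) :=
  ((List.range (n + 1)).map (fun i => sWord^[n - i] [z])).flatten

/-- The word `s^{n-1}(0) · s^{n-2}(0) ⋯ s(0) · 0`. -/
def bsuffix {k : ℕ} (z : Fin k) (n : ℕ) : List (Fin k) :=
  ((List.range n).map (fun i => sWord^[n - 1 - i] [z])).flatten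

open Filter Topology

section Words

variable {k : ℕ}

lemma sWord_append (u v : List (Fin k)) : sWord (u ++ v) = sWord u ++ sWord v := by
  simp [sWord]

lemma sWord_cons (a : Fin k) (v : List (Fin k)) : sWord (a :: v) = sLetter a ++ sWord v := by
  simp [sWord]

lemma sWord_singleton (a : Fin k) : sWord [a] = sLetter a := by
  simp [sWord]

lemma sWord_iterate_append (n : ℕ) (u v : List (Fin k)) :
    sWord^[n] (u ++ v) = sWord^[n] u ++ sWord^[n] v := by
  induction n generalizing u v with
  | zero => rfl
  | succ n ih => simp only [Function.iterate_succ_apply, sWord_append, ih]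

lemma sWord_iterate_nil (n : ℕ) : sWord^[n] ([] : List (Fin k)) = [] := by
  induction n with
  | zero => rfl
  | succ n ih => rw [Function.iterate_succ_apply]; exact ih

lemma one_le_length_sLetter (a : Fin k) : 1 ≤ (sLetter a).length := by
  unfold sLetter; split <;> simp

lemma length_le_length_sWord (w : List (Fin k)) : w.length ≤ (sWord w).length := by
  induction w with
  | nil => simp
  | cons a w ih =>
    have := one_le_length_sLetter a
    rw [sWord_cons, List.length_append, List.length_cons]
    omega

lemma sWord_iterate_ne_nil (n : ℕ) {w : List (Fin k)} (hw : w ≠ []) : sWord^[n] w ≠ [] := by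
  induction n with
  | zero => exact hw
  | succ n ih =>
    rw [Function.iterate_succ_apply', ← List.length_pos_iff]
    exact (List.length_pos_iff.2 ih).trans_le (length_le_length_sWord _)

lemma sWord_prefix {u v : List (Fin k)} (h : u <+: v) : sWord u <+: sWord v := by
  obtain ⟨t, rfl⟩ := h
  exact ⟨sWord t, (sWord_append u t).symm⟩

lemma sWord_iterate_infix {u v : List (Fin k)} (n : ℕ) (h : u <:+: v) :
    sWord^[n] u <:+: sWord^[n] v := by
  obtain ⟨p, q, rfl⟩ := h
  exact ⟨sWord^[n] p, sWord^[n] q, by simp only [sWord_iterate_append]⟩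

lemma sWord_infix {u v : List (Fin k)} (h : u <:+: v) : sWord u <:+: sWord v :=
  sWord_iterate_infix 1 h

lemma length_pref (x : ℕ → Fin k) (n : ℕ) : (pref x n).length = n := by
  simp [pref]

lemma pref_succ (x : ℕ → Fin k) (n : ℕ) : pref x (n + 1) = pref x n ++ [x n] := by
  simp [pref, List.range_succ]

lemma pref_succ' (x : ℕ → Fin k) (n : ℕ) : pref x (n + 1) = x 0 :: pref (shift x) n := by
  simp [pref, List.range_succ_eq_map, shift, Function.comp_def]

lemma pref_prefix (x : ℕ → Fin k) {m n : ℕ} (h : m ≤ n) : pref x m <+: pref x n := by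
  induction n, h using Nat.le_induction with
  | base => exact List.prefix_rfl
  | succ n _ ih => exact ih.trans ⟨[x n], (pref_succ x n).symm⟩

lemma sSeq_eq_getElem (x : ℕ → Fin k) {i n : ℕ} (h : i < (sWord (pref x n)).length) :
    sSeq x i = (sWord (pref x n))[i] := by
  have hi : i < (sWord (pref x (i + 1))).length := by
    have := length_le_length_sWord (pref x (i + 1))
    rw [length_pref] at this
    omega
  unfold sSeq
  rw [List.getD_eq_getElem _ _ hi]
  rcases le_total (i + 1) n with hn | hn
  · exact (sWord_prefix (pref_prefix x hn)).getElem hi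
  · exact ((sWord_prefix (pref_prefix x hn)).getElem h).symm

lemma pref_sSeq (x : ℕ → Fin k) {N n : ℕ} (h : N ≤ (sWord (pref x n)).length) :
    pref (sSeq x) N = (sWord (pref x n)).take N := by
  apply List.ext_getElem
  · simp [length_pref, h]
  · intro i h₁ h₂
    rw [length_pref] at h₁
    rw [List.getElem_take, ← sSeq_eq_getElem x (h₁.trans_le h)]
    simp [pref]

lemma pref_sSeq_append (x : ℕ → Fin k) {n : ℕ} {u v : List (Fin k)}
    (h : sWord (pref x n) = u ++ v) : pref (sSeq x) u.length = u := by
  rw [pref_sSeq x (n := n) (by simp [h]), h, List.take_left]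

lemma Lang.of_infix {u v : List (Fin k)} (hv : Lang v) (h : u <:+: v) : Lang u := by
  obtain ⟨a, m, hm⟩ := hv
  exact ⟨a, m, h.trans hm⟩

lemma Lang.sWord {w : List (Fin k)} (h : Lang w) : Lang (sWord w) := by
  obtain ⟨a, m, hm⟩ := h
  refine ⟨a, m + 1, ?_⟩
  rw [Function.iterate_succ_apply']
  exact sWord_infix hm

lemma Lang.pref_of_le {x : ℕ → Fin k} {m n : ℕ} (h : Lang (pref x n)) (hmn : m ≤ n) :
    Lang (pref x m) :=
  h.of_infix (pref_prefix x hmn).isInfix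

end Words

section Delta

variable {k : ℕ}

lemma delta_eq_top_iff (x : ℕ → Fin k) : delta x = ⊤ ↔ ∀ n, Lang (pref x n) := by
  unfold delta
  constructor
  · intro h n
    obtain ⟨_, ⟨m, rfl, hm⟩, hlt⟩ := sSup_eq_top.1 h n (ENat.natCast_lt_top n)
    exact hm.pref_of_le (by exact_mod_cast hlt.le)
  · intro h
    rw [ENat.eq_top_iff_forall_ge]
    intro m
    exact le_sSup ⟨m, rfl, h m⟩

/-- The prefix of length `d` is the longest prefix of `x` in the language. -/
def IsMaxPref (x : ℕ → Fin k) (d : ℕ) : Prop :=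
  Lang (pref x d) ∧ ¬ Lang (pref x (d + 1))

lemma IsMaxPref.delta_eq {x : ℕ → Fin k} {d : ℕ} (h : IsMaxPref x d) : delta x = d := by
  apply le_antisymm
  · apply sSup_le
    rintro _ ⟨n, rfl, hn⟩
    by_contra hlt
    have : d + 1 ≤ n := by
      rw [not_le] at hlt
      exact_mod_cast hlt
    exact h.2 (hn.pref_of_le this)
  · exact le_sSup ⟨d, rfl, h.1⟩

lemma lang_singleton (a : Fin k) : Lang [a] := ⟨a, 0, List.infix_rfl⟩

lemma IsMaxPref.pos {x : ℕ → Fin k} {d : ℕ} (h : IsMaxPref x d) : 1 ≤ d := by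
  by_contra hd
  obtain rfl : d = 0 := by omega
  exact h.2 (lang_singleton (x 0))

lemma exists_isMaxPref {x : ℕ → Fin k} (h : delta x ≠ ⊤) : ∃ d, IsMaxPref x d := by
  classical
  rw [Ne, delta_eq_top_iff, not_forall] at h
  have h0 : Nat.find h ≠ 0 := by
    intro h0
    have := Nat.find_spec h
    rw [h0] at this
    exact this ((lang_singleton (x 0)).of_infix (List.nil_infix))
  obtain ⟨d, hd⟩ := Nat.exists_eq_succ_of_ne_zero h0
  refine ⟨d, not_not.1 (Nat.find_min h (by omega)), ?_⟩
  have := Nat.find_spec h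
  rwa [hd] at this

lemma delta_sSeq_eq_top {x : ℕ → Fin k} (h : delta x = ⊤) : delta (sSeq x) = ⊤ := by
  rw [delta_eq_top_iff] at h ⊢
  intro n
  have hn := length_le_length_sWord (pref x n)
  rw [length_pref] at hn
  rw [pref_sSeq x hn]
  exact (h n).sWord.of_infix (List.take_prefix _ _).isInfix

lemma delta_shift_eq_top {x : ℕ → Fin k} (h : delta x = ⊤) : delta (shift x) = ⊤ := by
  rw [delta_eq_top_iff] at h ⊢
  intro n
  refine (h (n + 1)).of_infix ?_
  rw [pref_succ']
  exact (List.suffix_cons _ _).isInfix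

lemma delta_shift_iterate_eq_top {x : ℕ → Fin k} (h : delta x = ⊤) (j : ℕ) :
    delta (shift^[j] x) = ⊤ := by
  induction j with
  | zero => exact h
  | succ j ih => rw [Function.iterate_succ_apply']; exact delta_shift_eq_top ih

lemma Renorm_iterate_eq_zero {V : (ℕ → Fin k) → ℝ} (hV : ∀ x, delta x = ⊤ → V x = 0) (n : ℕ)
    {x : ℕ → Fin k} (hx : delta x = ⊤) : (Renorm^[n] V) x = 0 := by
  induction n generalizing x with
  | zero => exact hV x hx
  | succ n ih =>
    rw [Function.iterate_succ_apply']
    exact Finset.sum_eq_zero fun j _ => ih (delta_shift_iterate_eq_top (delta_sSeq_eq_top hx) j)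

end Delta

section Desubstitution

variable {k : ℕ} [NeZero k]

lemma sLetter_of_lt {a : Fin k} (h : (a : ℕ) + 1 < k) : sLetter a = [0, ⟨a + 1, h⟩] := by
  rw [sLetter, dif_pos h]; rfl

lemma sLetter_of_not_lt {a : Fin k} (h : ¬ (a : ℕ) + 1 < k) : sLetter a = [0] := by
  rw [sLetter, dif_neg h]; rfl

lemma exists_sLetter_eq_cons (a : Fin k) : ∃ t, sLetter a = 0 :: t := by
  by_cases h : (a : ℕ) + 1 < k
  · exact ⟨_, sLetter_of_lt h⟩
  · exact ⟨_, sLetter_of_not_lt h⟩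

/-- Inverse of the substitution: a nonzero letter comes from its predecessor, and a letter `0`
followed by another `0` comes from `k - 1`. -/
def desub : List (Fin k) → List (Fin k)
  | [] => []
  | b :: t =>
    if b = 0 then
      if t.head? = some 0 then ⟨k - 1, Nat.sub_lt (NeZero.pos k) one_pos⟩ :: desub t else desub t
    else ⟨b - 1, (Nat.sub_le _ _).trans_lt b.isLt⟩ :: desub t

lemma desub_suffix_cons (b : Fin k) (t : List (Fin k)) : desub t <:+ desub (b :: t) := by
  rw [desub]
  split_ifs
  · exact List.suffix_cons _ _
  · exact List.suffix_rfl
  · exact List.suffix_cons _ _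

lemma desub_suffix_append (u v : List (Fin k)) : desub v <:+ desub (u ++ v) := by
  induction u with
  | nil => exact List.suffix_rfl
  | cons b u ih => exact ih.trans (desub_suffix_cons b (u ++ v))

lemma desub_prefix_append (u v : List (Fin k)) : desub u <+: desub (u ++ v) := by
  induction u with
  | nil => exact List.nil_prefix
  | cons b u ih =>
    cases u with
    | nil =>
      rw [List.cons_append, desub, desub]
      by_cases hb : b = 0
      · simp [hb, desub]
      · simp [hb, desub]
    | cons c u =>
      rw [List.cons_append, desub, desub.eq_2 b (c :: u ++ v)]
      by_cases hb : b = 0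
      · by_cases hc : (c :: u).head? = some 0
        · rw [if_pos hb, if_pos hb, if_pos hc,
            if_pos (show (c :: u ++ v).head? = some 0 from hc)]
          exact (List.prefix_cons_inj _).2 ih
        · rw [if_pos hb, if_pos hb, if_neg hc,
            if_neg (show ¬ (c :: u ++ v).head? = some 0 from hc)]
          exact ih
      · rw [if_neg hb, if_neg hb]
        exact (List.prefix_cons_inj _).2 ih

lemma desub_infix {u v : List (Fin k)} (h : u <:+: v) : desub u <:+: desub v := by
  obtain ⟨p, q, rfl⟩ := h
  rw [List.append_assoc]
  exact (desub_prefix_append u q).isInfix.trans (desub_suffix_append p (u ++ q)).isInfix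

lemma head?_sWord_append_cons (v t : List (Fin k)) : (sWord v ++ 0 :: t).head? = some 0 := by
  cases v with
  | nil => rfl
  | cons a v =>
    obtain ⟨s, hs⟩ := exists_sLetter_eq_cons a
    rw [sWord_cons, hs]; rfl

lemma mk_succ_ne_zero {a : ℕ} (h : a + 1 < k) : (⟨a + 1, h⟩ : Fin k) ≠ 0 := by
  intro h0
  have := congrArg Fin.val h0
  simp at this

lemma desub_mk_succ_cons {a : Fin k} (h : (a : ℕ) + 1 < k) (t : List (Fin k)) :
    desub (⟨a + 1, h⟩ :: t) = a :: desub t := by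
  rw [desub, if_neg (mk_succ_ne_zero h)]
  congr 1

lemma desub_zero_cons_mk_succ_cons {a : Fin k} (h : (a : ℕ) + 1 < k) (t : List (Fin k)) :
    desub (0 :: ⟨a + 1, h⟩ :: t) = desub (⟨a + 1, h⟩ :: t) := by
  rw [desub, if_pos rfl, if_neg]
  simp [mk_succ_ne_zero h]

lemma desub_zero_cons_of_head? {a : Fin k} (h : ¬ (a : ℕ) + 1 < k) {t : List (Fin k)}
    (ht : t.head? = some 0) : desub (0 :: t) = a :: desub t := by
  rw [desub, if_pos rfl, if_pos ht]
  congr 1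
  ext
  have := a.isLt
  simp only
  omega

lemma desub_sWord_append_zero_cons (v t : List (Fin k)) :
    desub (sWord v ++ 0 :: t) = v ++ desub (0 :: t) := by
  induction v with
  | nil => rfl
  | cons a v ih =>
    by_cases h : (a : ℕ) + 1 < k
    · rw [sWord_cons, sLetter_of_lt h]
      simp only [List.cons_append, List.nil_append]
      rw [desub_zero_cons_mk_succ_cons, desub_mk_succ_cons, ih]
    · rw [sWord_cons, sLetter_of_not_lt h]
      simp only [List.cons_append, List.nil_append]
      rw [desub_zero_cons_of_head? h (head?_sWord_append_cons v t), ih]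

lemma desub_sWord_prefix (u : List (Fin k)) : desub (sWord u) <+: u := by
  have h := desub_prefix_append (sWord u) [0]
  rwa [desub_sWord_append_zero_cons, show desub [(0 : Fin k)] = [] by simp [desub],
    List.append_nil] at h

lemma Lang.desub {w : List (Fin k)} (h : Lang w) (hw : 2 ≤ w.length) : Lang (desub w) := by
  obtain ⟨a, m, hm⟩ := h
  cases m with
  | zero =>
    have := hm.length_le
    simp at this
    omega
  | succ m =>
    rw [Function.iterate_succ_apply'] at hm
    exact ⟨a, m, (desub_infix hm).trans (desub_sWord_prefix _).isInfix⟩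

lemma exists_sWord_iterate_zero_eq_append {j : ℕ} (hj : j < k) :
    ∃ u, sWord^[j] [(0 : Fin k)] = u ++ [⟨j, hj⟩] := by
  induction j with
  | zero => exact ⟨[], rfl⟩
  | succ j ih =>
    obtain ⟨u, hu⟩ := ih (by omega)
    refine ⟨sWord u ++ [0], ?_⟩
    rw [Function.iterate_succ_apply', hu, sWord_append, sWord_singleton,
      sLetter_of_lt (a := ⟨j, by omega⟩) hj]
    simp

lemma Lang.exists_append_singleton (hk : 2 ≤ k) {w : List (Fin k)} (h : Lang w) :
    ∃ b, Lang (w ++ [b]) := by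
  obtain ⟨a, m, p, q, hm⟩ := h
  have h1 : (0 : Fin k).val + 1 < k := by simp; omega
  obtain ⟨u, hu⟩ := exists_sWord_iterate_zero_eq_append a.isLt
  obtain ⟨c, t, hct⟩ := List.exists_cons_of_ne_nil
    (sWord_iterate_ne_nil (m + a) (List.cons_ne_nil (⟨(0 : Fin k).val + 1, h1⟩ : Fin k) []))
  have key : _root_.sWord^[m + a + 1] [(0 : Fin k)]
      = _root_.sWord^[m] u ++ p ++ w ++ (q ++ c :: t) := by
    rw [Function.iterate_succ_apply, sWord_singleton, sLetter_of_lt h1,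
      ← List.singleton_append, sWord_iterate_append, hct, Function.iterate_add_apply, hu,
      sWord_iterate_append, show (⟨(a : ℕ), a.isLt⟩ : Fin k) = a from rfl, ← hm]
    simp
  obtain ⟨b, t', hb⟩ := List.exists_cons_of_ne_nil (show q ++ c :: t ≠ [] by simp)
  refine ⟨b, 0, m + a + 1, _root_.sWord^[m] u ++ p, t', ?_⟩
  rw [key, hb]
  simp

lemma Lang.sWord_append_zero (hk : 2 ≤ k) {w : List (Fin k)} (h : Lang w) :
    Lang (_root_.sWord w ++ [0]) := by
  obtain ⟨b, hb⟩ := h.exists_append_singleton hk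
  obtain ⟨t, ht⟩ := exists_sLetter_eq_cons b
  refine hb.sWord.of_infix ⟨[], t, ?_⟩
  rw [sWord_append, sWord_singleton, ht]
  simp

lemma pref_sSeq_length_add_one (x : ℕ → Fin k) (d : ℕ) :
    pref (sSeq x) ((sWord (pref x d)).length + 1) = sWord (pref x d) ++ [0] := by
  obtain ⟨t, ht⟩ := exists_sLetter_eq_cons (x d)
  have := pref_sSeq_append x (n := d + 1) (u := sWord (pref x d) ++ [0]) (v := t)
    (by rw [pref_succ, sWord_append, sWord_singleton, ht]; simp)
  simpa using this

lemma exists_pref_sSeq_length_add_two (x : ℕ → Fin k) (d : ℕ) :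
    ∃ e, pref (sSeq x) ((sWord (pref x d)).length + 1 + 1) = sWord (pref x d) ++ [0, e] ∧
      desub [0, e] = [x d] := by
  obtain ⟨t, ht⟩ := exists_sLetter_eq_cons (x (d + 1))
  by_cases h : (x d : ℕ) + 1 < k
  · refine ⟨⟨x d + 1, h⟩, ?_, ?_⟩
    · have := pref_sSeq_append x (n := d + 1)
        (u := sWord (pref x d) ++ [0, ⟨x d + 1, h⟩]) (v := [])
        (by rw [pref_succ, sWord_append, sWord_singleton, sLetter_of_lt h]; simp)
      simpa using this
    · rw [desub_zero_cons_mk_succ_cons, desub_mk_succ_cons]; rfl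
  · refine ⟨0, ?_, ?_⟩
    · have := pref_sSeq_append x (n := d + 1 + 1)
        (u := sWord (pref x d) ++ [0, 0]) (v := t)
        (by rw [pref_succ, pref_succ, sWord_append, sWord_append, sWord_singleton,
              sWord_singleton, sLetter_of_not_lt h, ht]; simp)
      simpa using this
    · rw [desub_zero_cons_of_head? h rfl]; simp [desub]

lemma IsMaxPref.sSeq (hk : 2 ≤ k) {x : ℕ → Fin k} {d : ℕ} (h : IsMaxPref x d) :
    IsMaxPref (sSeq x) ((sWord (pref x d)).length + 1) := by
  obtain ⟨e, he, hde⟩ := exists_pref_sSeq_length_add_two x d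
  refine ⟨?_, fun hL => h.2 ?_⟩
  · rw [pref_sSeq_length_add_one]
    exact h.1.sWord_append_zero hk
  · rw [he] at hL
    have := hL.desub (by simp)
    rwa [desub_sWord_append_zero_cons, hde, ← pref_succ] at this

lemma sSeq_zero (x : ℕ → Fin k) : sSeq x 0 = 0 := by
  have := pref_sSeq_length_add_one x 0
  simpa [pref, sWord] using this

lemma sSeq_one {x : ℕ → Fin k} (h : (x 0 : ℕ) + 1 < k) : sSeq x 1 = ⟨x 0 + 1, h⟩ := by
  have := pref_sSeq_append x (n := 1) (u := [0, ⟨x 0 + 1, h⟩]) (v := [])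
    (by rw [pref_succ]; simp [pref, sWord_singleton, sLetter_of_lt h])
  have h2 : List.range 2 = [0, 1] := rfl
  simp [pref, h2] at this
  exact this.2

lemma IsMaxPref.shift_sSeq (hk : 2 ≤ k) {x : ℕ → Fin k} {d : ℕ} (h : IsMaxPref x d)
    (hx : (x 0 : ℕ) + 1 < k) :
    IsMaxPref (shift (_root_.sSeq x)) ((sWord (pref x d)).length) := by
  have hs := h.sSeq hk
  have hpos : 1 ≤ (sWord (pref x d)).length := by
    have := length_le_length_sWord (pref x d)
    rw [length_pref] at this
    exact h.pos.trans this
  refine ⟨hs.1.of_infix ?_, fun hL => h.2 ?_⟩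
  · rw [pref_succ' (_root_.sSeq x)]
    exact (List.suffix_cons _ _).isInfix
  · obtain ⟨e, he, hde⟩ := exists_pref_sSeq_length_add_two x d
    have hD := hL.desub (by rw [length_pref]; omega)
    have hcons : desub (pref (_root_.sSeq x) ((sWord (pref x d)).length + 1 + 1))
        = desub (pref (shift (_root_.sSeq x)) ((sWord (pref x d)).length + 1)) := by
      rw [pref_succ' (_root_.sSeq x), pref_succ' (shift (_root_.sSeq x)), sSeq_zero,
        show shift (_root_.sSeq x) 0 = _root_.sSeq x 1 from rfl, sSeq_one hx,
        desub_zero_cons_mk_succ_cons]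
    rwa [← hcons, he, desub_sWord_append_zero_cons, hde, ← pref_succ] at hD

end Desubstitution

section Sums

variable {k : ℕ}

/-- The length of the `n`-th image of a word. -/
def imageLength (n : ℕ) (w : List (Fin k)) : ℕ := (sWord^[n] w).length

lemma imageLength_zero (w : List (Fin k)) : imageLength 0 w = w.length := rfl

lemma imageLength_nil (n : ℕ) : imageLength n ([] : List (Fin k)) = 0 := by
  rw [imageLength, sWord_iterate_nil]; rfl

lemma imageLength_append (n : ℕ) (u v : List (Fin k)) :
    imageLength n (u ++ v) = imageLength n u + imageLength n v := by
  rw [imageLength, sWord_iterate_append, List.length_append]; rfl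

lemma imageLength_cons (n : ℕ) (a : Fin k) (v : List (Fin k)) :
    imageLength n (a :: v) = imageLength n [a] + imageLength n v :=
  imageLength_append n [a] v

lemma imageLength_sWord (n : ℕ) (w : List (Fin k)) :
    imageLength n (sWord w) = imageLength (n + 1) w := by
  rw [imageLength, imageLength, Function.iterate_succ_apply]

variable [NeZero k]

lemma imageLength_succ_of_lt (n : ℕ) {a : Fin k} (h : (a : ℕ) + 1 < k) :
    imageLength (n + 1) [a] = imageLength n [(0 : Fin k)] + imageLength n [⟨a + 1, h⟩] := by
  rw [← imageLength_sWord, sWord_singleton, sLetter_of_lt h, imageLength_cons]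

lemma imageLength_succ_of_not_lt (n : ℕ) {a : Fin k} (h : ¬ (a : ℕ) + 1 < k) :
    imageLength (n + 1) [a] = imageLength n [(0 : Fin k)] := by
  rw [← imageLength_sWord, sWord_singleton, sLetter_of_not_lt h]

variable (k) in
/-- The length of `bsuffix 0 n`. -/
def bsuffixLength (n : ℕ) : ℕ := ∑ i ∈ Finset.range n, imageLength i [(0 : Fin k)]

lemma bsuffixLength_succ (n : ℕ) :
    bsuffixLength k (n + 1) = bsuffixLength k n + imageLength n [(0 : Fin k)] :=
  Finset.sum_range_succ _ _

lemma Renorm_iterate_eq_sum (hk : 2 ≤ k) {V : (ℕ → Fin k) → ℝ}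
    (hV : ∀ x d, IsMaxPref x d → V x = 1 / (d : ℝ)) (n : ℕ) {x : ℕ → Fin k} {d : ℕ}
    (h : IsMaxPref x d) :
    (Renorm^[n] V) x = ∑ i ∈ Finset.range (imageLength n [x 0]),
      1 / (((imageLength n (pref x d) + bsuffixLength k n : ℕ) : ℝ) - i) := by
  induction n generalizing x d with
  | zero => simp [hV x d h, imageLength_zero, bsuffixLength, length_pref]
  | succ n ih =>
    rw [Function.iterate_succ_apply', Renorm]
    have h0 := ih (h.sSeq hk)
    have hD : imageLength n (sWord (pref x d) ++ [0]) + bsuffixLength k n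
        = imageLength (n + 1) (pref x d) + bsuffixLength k (n + 1) := by
      rw [imageLength_append, imageLength_sWord, bsuffixLength_succ]
      ring
    rw [pref_sSeq_length_add_one, hD, sSeq_zero] at h0
    by_cases hx : (x 0 : ℕ) + 1 < k
    · have h1 := ih (h.shift_sSeq hk hx)
      rw [show shift (sSeq x) 0 = sSeq x 1 from rfl, sSeq_one hx] at h1
      have htail := pref_succ' (sSeq x) (sWord (pref x d)).length
      rw [pref_sSeq_length_add_one, sSeq_zero] at htail
      rw [htail, imageLength_cons] at hD
      rw [sLetter_of_lt hx, imageLength_succ_of_lt n hx, Finset.sum_range_add]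
      simp only [List.length_cons, List.length_nil, Nat.reduceAdd, Finset.sum_range_succ,
        Finset.sum_range_zero, zero_add, Function.iterate_zero_apply, Function.iterate_one]
      rw [h0, h1, ← hD]
      congr 1
      apply Finset.sum_congr rfl
      intro i _
      push_cast
      congr 1
      ring
    · rw [sLetter_of_not_lt hx, imageLength_succ_of_not_lt n hx]
      simpa using h0

end Sums

section Asymptotics

lemma abs_mul_sub_mul_le {s t θ x y D : ℝ} (hs : 0 ≤ s) (hsθ : s ≤ θ) (ht : 0 ≤ t) (htθ : t ≤ θ)
    (hx : |x| ≤ D) (hy : |y| ≤ D) (hxy : |x - y| ≤ D) : |s * x - t * y| ≤ θ * D := by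
  have hθ : 0 ≤ θ := hs.trans hsθ
  rw [abs_le] at *
  have key : ∀ {c z : ℝ}, 0 ≤ c → c ≤ θ →
      0 ≤ z ∧ 0 ≤ c * z ∧ c * z ≤ θ * z ∨ z ≤ 0 ∧ c * z ≤ 0 ∧ θ * z ≤ c * z := by
    intro c z hc hcθ
    rcases le_total 0 z with hz | hz
    · exact .inl ⟨hz, mul_nonneg hc hz, mul_le_mul_of_nonneg_right hcθ hz⟩
    · exact .inr ⟨hz, mul_nonpos_of_nonneg_of_nonpos hc hz, mul_le_mul_of_nonpos_right hcθ hz⟩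
  have h1 := mul_le_mul_of_nonneg_left hx.1 hθ
  have h2 := mul_le_mul_of_nonneg_left hx.2 hθ
  have h3 := mul_le_mul_of_nonneg_left hy.1 hθ
  have h4 := mul_le_mul_of_nonneg_left hy.2 hθ
  have h5 := mul_le_mul_of_nonneg_left hxy.1 hθ
  have h6 := mul_le_mul_of_nonneg_left hxy.2 hθ
  rw [mul_neg] at h1 h3 h5
  rw [mul_sub] at h5 h6
  rcases key (z := x) hs hsθ with ⟨_, _, _⟩ | ⟨_, _, _⟩ <;>
    rcases key (z := y) ht htθ with ⟨_, _, _⟩ | ⟨_, _, _⟩ <;>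
    constructor <;> linarith

/-- Iterated averages that all give a positive weight to the same index become constant. -/
lemma exists_tendsto_of_convex_recurrence {ι : Type*} [Finite ι] (o : ι) (next : ι → ι)
    (α : ι → ℝ) (hα : ∀ i, 0 < α i) (hα1 : ∀ i, α i ≤ 1) (r : ℕ → ι → ℝ)
    (hr : ∀ n i, r (n + 1) i = α i * r n o + (1 - α i) * r n (next i)) :
    ∃ C, ∀ i, Tendsto (fun n => r n i) atTop (𝓝 C) := by
  have : Nonempty ι := ⟨o⟩
  obtain ⟨i₀, hi₀⟩ := Finite.exists_min α
  obtain ⟨p₀, hp₀⟩ := Finite.exists_max (fun p : ι × ι => |r 0 p.1 - r 0 p.2|)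
  set θ := 1 - α i₀ with hθ
  set K := |r 0 p₀.1 - r 0 p₀.2| with hK
  have hθ0 : 0 ≤ θ := sub_nonneg.2 (hα1 i₀)
  have hθ1 : θ < 1 := by linarith [hα i₀]
  have hle : ∀ i, 1 - α i ≤ θ := fun i => by linarith [hi₀ i]
  have hnn : ∀ i, 0 ≤ 1 - α i := fun i => sub_nonneg.2 (hα1 i)
  have hosc : ∀ n i j, |r n i - r n j| ≤ K * θ ^ n := by
    intro n
    induction n with
    | zero => intro i j; simpa using hp₀ (i, j)
    | succ n ih =>
      intro i j
      have := abs_mul_sub_mul_le (hnn i) (hle i) (hnn j) (hle j) (ih (next i) o) (ih (next j) o)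
        (by simpa using ih (next i) (next j))
      rw [hr, hr, pow_succ]
      convert this using 1
      · congr 1; ring
      · ring
  have hc : CauchySeq (fun n => r n o) := by
    refine cauchySeq_of_le_geometric θ K hθ1 fun n => ?_
    rw [dist_comm, Real.dist_eq, hr,
      show α o * r n o + (1 - α o) * r n (next o) - r n o
        = (1 - α o) * (r n (next o) - r n o) by ring, abs_mul, abs_of_nonneg (hnn o)]
    have h1 := hosc n (next o) o
    have h2 : 1 - α o ≤ 1 := by linarith [hα o]
    exact (mul_le_of_le_one_left (abs_nonneg _) h2).trans h1
  obtain ⟨C, hC⟩ := cauchySeq_tendsto_of_complete hc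
  refine ⟨C, fun i => ?_⟩
  have h0 : Tendsto (fun n => r n i - r n o) atTop (𝓝 0) := by
    refine squeeze_zero_norm (fun n => hosc n i o) ?_
    simpa using (tendsto_pow_atTop_nhds_zero_of_lt_one hθ0 hθ1).const_mul K
  simpa using h0.add hC

lemma inv_le_log_div {m : ℝ} (hm : 1 < m) : 1 / m ≤ Real.log (m / (m - 1)) := by
  have h := Real.log_le_sub_one_of_pos (show 0 < (m - 1) / m by apply div_pos <;> linarith)
  rw [← inv_div (m - 1) m, Real.log_inv]
  have : (m - 1) / m - 1 = -(1 / m) := by field_simp; ring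
  linarith

lemma log_div_le_inv {m : ℝ} (hm : 0 < m) : Real.log ((m + 1) / m) ≤ 1 / m := by
  have h := Real.log_le_sub_one_of_pos (show 0 < (m + 1) / m by positivity)
  have : (m + 1) / m - 1 = 1 / m := by field_simp; ring
  linarith

lemma sum_inv_le_log {L : ℕ} {D : ℝ} (h : (L : ℝ) < D) :
    ∑ i ∈ Finset.range L, 1 / (D - i) ≤ Real.log (D / (D - L)) := by
  induction L with
  | zero => have : D ≠ 0 := by simp at h; exact h.ne'
            simp [this]
  | succ L ih =>
    push_cast at h ⊢
    have hL : (0 : ℝ) ≤ L := L.cast_nonneg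
    rw [Finset.sum_range_succ]
    have h1 := ih (by linarith)
    have h2 := inv_le_log_div (show 1 < D - L by linarith)
    rw [Real.log_div (by linarith) (by linarith)] at h1 h2 ⊢
    rw [← sub_sub]
    linarith

lemma log_le_sum_inv {L : ℕ} {D : ℝ} (h : (L : ℝ) < D) :
    Real.log ((D + 1) / (D - L + 1)) ≤ ∑ i ∈ Finset.range L, 1 / (D - i) := by
  induction L with
  | zero => have : D + 1 ≠ 0 := by simp at h; linarith
            simp [this]
  | succ L ih =>
    push_cast at h ⊢
    have hL : (0 : ℝ) ≤ L := L.cast_nonneg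
    rw [Finset.sum_range_succ]
    have h1 := ih (by linarith)
    have h2 := log_div_le_inv (show 0 < D - L by linarith)
    rw [Real.log_div (by linarith) (by linarith)] at h1 h2 ⊢
    rw [show D - (L + 1) + 1 = D - L by ring]
    linarith

lemma tendsto_sum_inv {L : ℕ → ℕ} {D c : ℕ → ℝ} {l m : ℝ} (hc : ∀ n, 0 < c n)
    (hc_top : Tendsto c atTop atTop) (hL : Tendsto (fun n => L n / c n) atTop (𝓝 l))
    (hD : Tendsto (fun n => D n / c n) atTop (𝓝 m)) (hl : 0 ≤ l) (hlm : l < m)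
    (hLD : ∀ᶠ n in atTop, (L n : ℝ) < D n) :
    Tendsto (fun n => ∑ i ∈ Finset.range (L n), 1 / (D n - i)) atTop
      (𝓝 (Real.log (m / (m - l)))) := by
  have hm : m / (m - l) ≠ 0 := (div_pos (by linarith) (by linarith)).ne'
  have h0 : Tendsto (fun n => 1 / c n) atTop (𝓝 0) := by
    simpa [Pi.inv_def] using hc_top.inv_tendsto_atTop
  have hlow := (((hD.add h0).div ((hD.sub hL).add h0) (by linarith)).log (by simpa using hm))
  have hup := ((hD.div (hD.sub hL) (by linarith)).log hm)
  rw [add_zero, add_zero] at hlow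
  refine tendsto_of_tendsto_of_tendsto_of_le_of_le' hlow hup ?_ ?_
  · filter_upwards [hLD] with n hn
    refine le_of_eq_of_le ?_ (log_le_sum_inv hn)
    have := (hc n).ne'
    rw [Pi.div_apply, ← add_div, ← sub_div, ← add_div, div_div_div_cancel_right₀ this]
  · filter_upwards [hLD] with n hn
    refine (sum_inv_le_log hn).trans_eq ?_
    have := (hc n).ne'
    rw [Pi.div_apply, ← sub_div, div_div_div_cancel_right₀ this]

end Asymptotics

section Growth

variable {k : ℕ} {lam : ℝ}

lemma vcoef_zero (hk : 1 ≤ k) (hlam : 0 < lam)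
    (hroot : lam ^ k = ∑ j ∈ Finset.range k, lam ^ j) : vcoef k lam 0 = lam := by
  obtain ⟨k, rfl⟩ := Nat.exists_eq_add_of_le' hk
  simp only [vcoef, Nat.sub_zero, ← hroot, Nat.add_sub_cancel]
  rw [pow_succ, mul_div_cancel_left₀ _ (pow_ne_zero _ hlam.ne')]

lemma vcoef_succ (hlam : 0 < lam) {l : ℕ} (hl : l + 1 < k) :
    lam * vcoef k lam l = lam + vcoef k lam (l + 1) := by
  obtain ⟨j, rfl⟩ : ∃ j, k = l + 1 + 1 + j := Nat.exists_eq_add_of_le hl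
  simp only [vcoef, show l + 1 + 1 + j - l = j + 1 + 1 by omega,
    show l + 1 + 1 + j - 1 - l = j + 1 by omega, show l + 1 + 1 + j - (l + 1) = j + 1 by omega,
    show l + 1 + 1 + j - 1 - (l + 1) = j by omega]
  rw [Finset.sum_range_succ _ (j + 1)]
  field_simp
  ring

lemma vcoef_last {l : ℕ} (hl : l + 1 = k) : vcoef k lam l = 1 := by
  subst hl
  simp [vcoef]

lemma one_le_vcoef (hlam : 0 < lam) {l : ℕ} (hl : l < k) : 1 ≤ vcoef k lam l := by
  rw [vcoef, one_le_div (by positivity)]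
  exact Finset.single_le_sum (f := fun j => lam ^ j) (fun i _ => by positivity)
    (Finset.mem_range.2 (by omega))

lemma tendsto_imageLength_word {C : ℝ}
    (h : ∀ a : Fin k, Tendsto (fun n => (imageLength n [a] : ℝ) / lam ^ n) atTop
      (𝓝 (C * vcoef k lam a))) (w : List (Fin k)) :
    Tendsto (fun n => (imageLength n w : ℝ) / lam ^ n) atTop
      (𝓝 (C * ∑ l : Fin k, vcoef k lam (l : ℕ) * (w.count l : ℝ))) := by
  induction w with
  | nil => simp [imageLength_nil]
  | cons a w ih =>
    have hsum : ∑ l : Fin k, vcoef k lam (l : ℕ) * ((a :: w).count l : ℝ)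
        = vcoef k lam a + ∑ l : Fin k, vcoef k lam (l : ℕ) * (w.count l : ℝ) := by
      simp [List.count_cons, mul_add, Finset.sum_add_distrib, add_comm]
    rw [hsum, mul_add]
    refine ((h a).add ih).congr fun n => ?_
    rw [imageLength_cons n a w, ← add_div]
    push_cast
    rfl

lemma vcoef_le_sum_count (hlam : 0 < lam) {a : Fin k} {w : List (Fin k)} (h : a ∈ w) :
    vcoef k lam a ≤ ∑ l : Fin k, vcoef k lam (l : ℕ) * (w.count l : ℝ) := by
  have hv : ∀ l : Fin k, 0 ≤ vcoef k lam l := fun l =>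
    zero_le_one.trans (one_le_vcoef hlam l.isLt)
  have h1 : (1 : ℝ) ≤ w.count a := by exact_mod_cast List.count_pos_iff.2 h
  exact (le_mul_of_one_le_right (hv a) h1).trans
    (Finset.single_le_sum (f := fun l : Fin k => vcoef k lam (l : ℕ) * (w.count l : ℝ))
      (fun l _ => mul_nonneg (hv l) (Nat.cast_nonneg _)) (Finset.mem_univ a))

variable [NeZero k]

/-- The lengths of the images of the letters, normalised by their expected growth; the extra index
stands for `bsuffixLength`. -/
noncomputable def normLength (lam : ℝ) (n : ℕ) : Option (Fin k) → ℝ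
  | none => bsuffixLength k n / (lam ^ n * (lam / (lam - 1)))
  | some a => imageLength n [a] / (lam ^ n * vcoef k lam a)

lemma exists_tendsto_normLength (hlam : 1 < lam)
    (hroot : lam ^ k = ∑ j ∈ Finset.range k, lam ^ j) :
    ∃ C, ∀ i, Tendsto (fun n => normLength (k := k) lam n i) atTop (𝓝 C) := by
  have hlam0 : 0 < lam := by linarith
  have hv : ∀ a : Fin k, 1 ≤ vcoef k lam a := fun a => one_le_vcoef hlam0 a.isLt
  have hv0 : vcoef k lam ((0 : Fin k) : ℕ) = lam := by
    simpa using vcoef_zero (NeZero.one_le) hlam0 hroot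
  refine exists_tendsto_of_convex_recurrence (some 0)
    (fun i => i.bind fun a : Fin k => some (if h : (a : ℕ) + 1 < k then ⟨a + 1, h⟩ else a))
    (fun i => i.elim (1 - 1 / lam) fun a : Fin k => 1 / vcoef k lam a) ?_ ?_ _ ?_
  · rintro (_ | a)
    · have : 1 / lam < 1 := by rw [div_lt_one hlam0]; exact hlam
      simpa using this
    · have := hv a
      simp only [Option.elim_some]
      positivity
  · rintro (_ | a)
    · have : 0 < 1 / lam := by positivity
      simp only [Option.elim_none]
      linarith
    · simp only [Option.elim_some]
      rw [div_le_one (by linarith [hv a])]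
      exact hv a
  · rintro n (_ | a)
    · have : lam - 1 ≠ 0 := by linarith
      simp only [normLength, Option.elim_none, Option.bind_none, bsuffixLength_succ, hv0]
      push_cast
      field_simp
      ring
    · have hva : vcoef k lam a ≠ 0 := by linarith [hv a]
      simp only [normLength, Option.elim_some, Option.bind_some, hv0]
      by_cases h : (a : ℕ) + 1 < k
      · have hvs : vcoef k lam (a + 1) = lam * vcoef k lam a - lam := by
          linarith [vcoef_succ hlam0 h]
        have hvs0 : lam * vcoef k lam a - lam ≠ 0 := by
          rw [← hvs]; linarith [one_le_vcoef (k := k) hlam0 h]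
        have hv1 : vcoef k lam a - 1 ≠ 0 := by
          intro h0; apply hvs0; rw [show lam * vcoef k lam a - lam
            = lam * (vcoef k lam a - 1) by ring, h0, mul_zero]
        rw [dif_pos h, imageLength_succ_of_lt n h]
        simp only [hvs]
        rw [show lam * vcoef k lam a - lam = lam * (vcoef k lam a - 1) by ring]
        push_cast
        field_simp
        ring
      · have hv1 : vcoef k lam a = 1 := vcoef_last (by have := a.isLt; omega)
        rw [imageLength_succ_of_not_lt n h, hv1, pow_succ]
        simp

lemma exists_pos_mul_le_imageLength (hlam : 1 < lam)
    (hroot : lam ^ k = ∑ j ∈ Finset.range k, lam ^ j) :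
    ∃ c : ℝ, 0 < c ∧ ∀ n (a : Fin k), c * (lam ^ n * vcoef k lam a) ≤ imageLength n [a] := by
  have hlam0 : 0 < lam := by linarith
  have hv : ∀ a : Fin k, 1 ≤ vcoef k lam a := fun a => one_le_vcoef hlam0 a.isLt
  have hv0 : vcoef k lam ((0 : Fin k) : ℕ) = lam := by
    simpa using vcoef_zero (NeZero.one_le) hlam0 hroot
  obtain ⟨b, hb⟩ := Finite.exists_max fun a : Fin k => vcoef k lam a
  have hb0 : 0 < vcoef k lam b := by linarith [hv b]
  refine ⟨1 / vcoef k lam b, by positivity, fun n => ?_⟩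
  induction n with
  | zero =>
    intro a
    rw [imageLength_zero, one_div_mul_eq_div, div_le_iff₀ hb0]
    simpa using hb a
  | succ n ih =>
    intro a
    have h0 := ih 0
    rw [hv0] at h0
    by_cases h : (a : ℕ) + 1 < k
    · have h1 := ih ⟨a + 1, h⟩
      rw [imageLength_succ_of_lt n h, pow_succ, mul_assoc, vcoef_succ hlam0 h, mul_add, mul_add]
      push_cast
      exact add_le_add h0 h1
    · have hv1 : vcoef k lam a = 1 := vcoef_last (by have := a.isLt; omega)
      rw [imageLength_succ_of_not_lt n h, hv1, pow_succ, mul_one]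
      exact h0

lemma exists_tendsto_imageLength (hlam : 1 < lam)
    (hroot : lam ^ k = ∑ j ∈ Finset.range k, lam ^ j) :
    ∃ C : ℝ, 0 < C ∧
      (∀ a : Fin k, Tendsto (fun n => (imageLength n [a] : ℝ) / lam ^ n) atTop
        (𝓝 (C * vcoef k lam a))) ∧
      Tendsto (fun n => (bsuffixLength k n : ℝ) / lam ^ n) atTop (𝓝 (C * (lam / (lam - 1)))) := by
  have hlam0 : 0 < lam := by linarith
  have hv : ∀ a : Fin k, 1 ≤ vcoef k lam a := fun a => one_le_vcoef hlam0 a.isLt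
  obtain ⟨C, hC⟩ := exists_tendsto_normLength (k := k) hlam hroot
  obtain ⟨c, hc, hle⟩ := exists_pos_mul_le_imageLength (k := k) hlam hroot
  refine ⟨C, hc.trans_le (ge_of_tendsto' (hC (some 0)) fun n => ?_), fun a => ?_, ?_⟩
  · have := hv 0
    rw [normLength, le_div_iff₀ (by positivity)]
    exact hle n 0
  · have := hv a
    refine ((hC (some a)).mul_const (vcoef k lam a)).congr fun n => ?_
    rw [normLength]
    field_simp
  · have : lam - 1 ≠ 0 := by linarith
    refine ((hC none).mul_const (lam / (lam - 1))).congr fun n => ?_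
    rw [normLength]
    field_simp

end Growth

theorem stmt8 (k : ℕ) (hk : 2 ≤ k) (lam : ℝ) (hlam : 1 < lam)
    (hroot : lam ^ k = ∑ j ∈ Finset.range k, lam ^ j)
    (V₀ : (ℕ → Fin k) → ℝ)
    (hV₀ : ∀ x, V₀ x = if delta x = ⊤ then 0 else 1 / ((delta x).toNat : ℝ))
    (x : ℕ → Fin k) :
    Filter.Tendsto (fun n => (Renorm^[n] V₀) x) Filter.atTop (nhds (Ufix k lam x)) := by
  have : NeZero k := ⟨by omega⟩
  have hlam0 : 0 < lam := by linarith
  by_cases hx : delta x = ⊤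
  · have h0 : ∀ n, (Renorm^[n] V₀) x = 0 := fun n =>
      Renorm_iterate_eq_zero (fun y hy => by rw [hV₀, if_pos hy]) n hx
    simp [h0, Ufix, hx]
  obtain ⟨d, hd⟩ := exists_isMaxPref hx
  have hV : ∀ x d, IsMaxPref x d → V₀ x = 1 / (d : ℝ) := by
    intro y e he
    rw [hV₀, he.delta_eq, if_neg (ENat.natCast_ne_top e), ENat.toNat_natCast]
  obtain ⟨C, hC, hlen, hb⟩ := exists_tendsto_imageLength (k := k) hlam hroot
  obtain ⟨t, ht⟩ : ∃ t, pref x d = x 0 :: t := by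
    obtain ⟨e, rfl⟩ := Nat.exists_eq_add_of_le' hd.pos
    exact ⟨_, pref_succ' x e⟩
  have hle := vcoef_le_sum_count hlam0 (a := x 0) (w := pref x d) (by simp [ht])
  have hpos : 0 < lam / (lam - 1) := div_pos hlam0 (by linarith)
  have hv : 0 ≤ vcoef k lam (x 0) := zero_le_one.trans (one_le_vcoef hlam0 (x 0).isLt)
  have hD : Tendsto (fun n => ((imageLength n (pref x d) + bsuffixLength k n : ℕ) : ℝ) / lam ^ n)
      atTop (𝓝 (C * (lam / (lam - 1)
        + ∑ l : Fin k, vcoef k lam (l : ℕ) * ((pref x d).count l : ℝ)))) := by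
    rw [mul_add]
    refine (hb.add (tendsto_imageLength_word hlen (pref x d))).congr fun n => ?_
    push_cast
    ring
  have hLD : ∀ᶠ n in atTop, (imageLength n [x 0] : ℝ)
      < ((imageLength n (pref x d) + bsuffixLength k n : ℕ) : ℝ) := by
    filter_upwards [eventually_ge_atTop 1] with n hn
    have h1 : 1 ≤ bsuffixLength k n :=
      Finset.single_le_sum (f := fun i => imageLength i [(0 : Fin k)]) (fun _ _ => Nat.zero_le _)
        (Finset.mem_range.2 hn)
    rw [ht, imageLength_cons n _ t]
    exact_mod_cast (show imageLength n [x 0] <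
      imageLength n [x 0] + imageLength n t + bsuffixLength k n by omega)
  have key := tendsto_sum_inv (fun n => pow_pos hlam0 n) (tendsto_pow_atTop_atTop_of_one_lt hlam)
    (hlen (x 0)) hD (mul_nonneg hC.le hv) (mul_lt_mul_of_pos_left (by linarith) hC) hLD
  simp only [← Renorm_iterate_eq_sum hk hV _ hd] at key
  convert key using 2
  rw [Ufix, if_neg hx, hd.delta_eq, ENat.toNat_natCast, ← mul_sub, mul_div_mul_left _ _ hC.ne',
    one_add_div (by linarith)]
  congr 2
  ring
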